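/- arXiv:1307.8192 — 2 statements merged into one kernel-verified Lean document; each statement's English description precedes it below -/
import Mathlib

section
/- In Morpion Solitaire 5D, no play of length 122 exists; equivalently, the score of every play of Morpion Solitaire 5D is at most 121. -/
/-- The four directions of Morpion Solitaire. -/
def Dir : Set (ℤ × ℤ) := {(1, 0), (0, 1), (1, 1), (1, -1)}

/-- The line (segment) of length 5 starting at `q` in direction `d`:
the set `{q + t • d : t ∈ {0,1,2,3,4}}`. -/
def seg (q d : ℤ × ℤ) : Set (ℤ × ℤ) := {p | ∃ t : ℕ, t ≤ 4 ∧ p = q + (t : ℤ) • d}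

/-- The initial configuration of 36 crosses. -/
def S0 : Set (ℤ × ℤ) := {p |
  ((p.2 = 0 ∨ p.2 = 9) ∧ 3 ≤ p.1 ∧ p.1 ≤ 6) ∨
  ((p.1 = 0 ∨ p.1 = 9) ∧ 3 ≤ p.2 ∧ p.2 ≤ 6) ∨
  ((p.1 = 3 ∨ p.1 = 6) ∧ ((0 ≤ p.2 ∧ p.2 ≤ 3) ∨ (6 ≤ p.2 ∧ p.2 ≤ 9))) ∨
  ((p.2 = 3 ∨ p.2 = 6) ∧ ((0 ≤ p.1 ∧ p.1 ≤ 3) ∨ (6 ≤ p.1 ∧ p.1 ≤ 9)))}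

/-- A play of Morpion Solitaire 5D of length `N`: crosses `p i`, and lines
`seg (q i) (d i)` in directions `d i ∈ Dir`, subject to the rules of 5D.
(Index `i : Fin N` corresponds to move `i + 1`.) -/
structure Play (N : ℕ) where
  p : Fin N → ℤ × ℤ
  q : Fin N → ℤ × ℤ
  d : Fin N → ℤ × ℤ
  d_mem : ∀ i, d i ∈ Dir
  /-- rule (1): the new cross is placed on an empty point -/
  p_not_S0 : ∀ i, p i ∉ S0
  p_new : ∀ i j : Fin N, j < i → p j ≠ p i
  /-- rule (2): the new line passes through the new cross -/
  p_mem : ∀ i, p i ∈ seg (q i) (d i)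
  /-- rule (3): the new line passes only through existing crosses -/
  seg_sub : ∀ i, seg (q i) (d i) ⊆ S0 ∪ {x | ∃ j : Fin N, j ≤ i ∧ p j = x}
  /-- rule (4): two lines in the same direction are disjoint -/
  disj : ∀ i j : Fin N, j < i → d j = d i → seg (q i) (d i) ∩ seg (q j) (d j) = ∅

/-- The initial configuration as a finite set. -/
noncomputable def S0Finset : Finset (ℤ × ℤ) :=
  (Finset.Icc (0 : ℤ) 9 ×ˢ Finset.Icc (0 : ℤ) 9).filter fun p =>
    ((p.2 = 0 ∨ p.2 = 9) ∧ 3 ≤ p.1 ∧ p.1 ≤ 6) ∨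
    ((p.1 = 0 ∨ p.1 = 9) ∧ 3 ≤ p.2 ∧ p.2 ≤ 6) ∨
    ((p.1 = 3 ∨ p.1 = 6) ∧ ((0 ≤ p.2 ∧ p.2 ≤ 3) ∨ (6 ≤ p.2 ∧ p.2 ≤ 9))) ∨
    ((p.2 = 3 ∨ p.2 = 6) ∧ ((0 ≤ p.1 ∧ p.1 ≤ 3) ∨ (6 ≤ p.1 ∧ p.1 ≤ 9)))

theorem card_S0Finset : S0Finset.card = 36 := by decide +kernel

theorem mem_S0Finset {x : ℤ × ℤ} (hx : x ∈ S0) : x ∈ S0Finset := by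
  simp only [S0, Set.mem_ofPred_eq] at hx
  simp only [S0Finset, Finset.mem_filter, Finset.mem_product, Finset.mem_Icc]
  exact ⟨by omega, hx⟩

/-- The four directions as a finite set. -/
def dirFinset : Finset (ℤ × ℤ) := {(1, 0), (0, 1), (1, 1), (1, -1)}

theorem mem_dirFinset {e : ℤ × ℤ} : e ∈ dirFinset ↔ e ∈ Dir := by
  simp [dirFinset, Dir]

/-- The determinant of `e` and `x` modulo 5; it is constant along lines in direction `e`. -/
def crossMod (e x : ℤ × ℤ) : ZMod 5 := ((e.1 * x.2 - e.2 * x.1 : ℤ) : ZMod 5)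

theorem crossMod_add_smul (e x y : ℤ × ℤ) (t : ℕ) :
    crossMod e (x + (t : ℤ) • y) = crossMod e x + t * crossMod e y := by
  simp only [crossMod, Prod.fst_add, Prod.snd_add, Prod.smul_fst, Prod.smul_snd, smul_eq_mul]
  push_cast
  ring

theorem crossMod_self (e : ℤ × ℤ) : crossMod e e = 0 := by
  simp [crossMod, mul_comm]

theorem crossMod_ne_zero : ∀ e ∈ dirFinset, ∀ f ∈ dirFinset, e ≠ f → crossMod e f ≠ 0 := by
  decide +kernel

/-- An arithmetic progression of length 5 with nonzero step avoids a given residue 4 times. -/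
theorem card_filter_add_mul_ne : ∀ a b c : ZMod 5, b ≠ 0 →
    ((Finset.range 5).filter fun t : ℕ => a + t * b ≠ c).card = 4 := by
  decide +kernel

namespace Play

variable {N : ℕ}

/-- The first `M` moves of a play. -/
def truncate {M : ℕ} (h : M ≤ N) (P : Play N) : Play M where
  p i := P.p (Fin.castLE h i)
  q i := P.q (Fin.castLE h i)
  d i := P.d (Fin.castLE h i)
  d_mem _ := P.d_mem _
  p_not_S0 _ := P.p_not_S0 _
  p_new _ _ hij := P.p_new _ _ hij
  p_mem _ := P.p_mem _
  seg_sub i x hx := by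
    rcases P.seg_sub _ hx with h0 | ⟨j, hj, rfl⟩
    · exact Or.inl h0
    · exact Or.inr ⟨⟨j, lt_of_le_of_lt hj i.2⟩, hj, rfl⟩
  disj _ _ hij hd := P.disj _ _ hij hd

/-- The `t`-th point of the `i`-th line. -/
def point (P : Play N) (i : Fin N) (t : ℕ) : ℤ × ℤ := P.q i + (t : ℤ) • P.d i

/-- All crosses on the board at the end of a play. -/
noncomputable def board (P : Play N) : Finset (ℤ × ℤ) := S0Finset ∪ Finset.univ.image P.p

/-- The moves whose line has direction `e`. -/
def movesIn (P : Play N) (e : ℤ × ℤ) : Finset (Fin N) := Finset.univ.filter fun i => P.d i = e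

theorem card_board_le (P : Play N) : P.board.card ≤ 36 + N := by
  refine (Finset.card_union_le _ _).trans ?_
  rw [card_S0Finset]
  gcongr
  simpa using Finset.card_image_le (s := Finset.univ) (f := P.p)

theorem point_mem_seg (P : Play N) (i : Fin N) {t : ℕ} (ht : t ∈ Finset.range 5) :
    P.point i t ∈ seg (P.q i) (P.d i) :=
  ⟨t, Nat.le_of_lt_succ (Finset.mem_range.mp ht), rfl⟩

theorem point_mem_board (P : Play N) (i : Fin N) {t : ℕ} (ht : t ∈ Finset.range 5) :
    P.point i t ∈ P.board := by
  rcases P.seg_sub i (P.point_mem_seg i ht) with h | ⟨j, -, hj⟩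
  · exact Finset.mem_union_left _ (mem_S0Finset h)
  · exact Finset.mem_union_right _ (Finset.mem_image.mpr ⟨j, Finset.mem_univ _, hj⟩)

theorem point_injective (P : Play N) (i : Fin N) : Function.Injective (P.point i) := by
  intro s t h
  have hne : P.d i ≠ 0 := by
    intro h0
    have := P.d_mem i
    simp [h0, Dir, Prod.ext_iff] at this
  have := smul_left_injective ℤ hne (add_left_cancel h)
  exact_mod_cast this

/-- Lines in a common direction are disjoint, so the points selected on them can be counted
line by line. -/
theorem card_biUnion_point (P : Play N) {e : ℤ × ℤ} {A : Finset (Fin N)} (hA : A ⊆ P.movesIn e)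
    {τ : Fin N → Finset ℕ} (hτ : ∀ i, τ i ⊆ Finset.range 5) :
    (A.biUnion fun i => (τ i).image (P.point i)).card = ∑ i ∈ A, (τ i).card := by
  rw [Finset.card_biUnion]
  · exact Finset.sum_congr rfl fun i _ => Finset.card_image_of_injective _ (P.point_injective i)
  · intro i hi j hj hij
    have hd : P.d i = P.d j :=
      (Finset.mem_filter.mp (hA hi)).2.trans (Finset.mem_filter.mp (hA hj)).2.symm
    refine Finset.disjoint_left.mpr ?_
    intro x hxi hxj
    obtain ⟨s, hs, rfl⟩ := Finset.mem_image.mp hxi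
    obtain ⟨t, ht, hst⟩ := Finset.mem_image.mp hxj
    have h1 := P.point_mem_seg i (hτ i hs)
    have h2 := P.point_mem_seg j (hτ j ht)
    rw [hst] at h2
    rcases lt_or_gt_of_ne hij with h | h
    · exact Set.eq_empty_iff_forall_notMem.mp (P.disj j i h hd) _ ⟨h2, h1⟩
    · exact Set.eq_empty_iff_forall_notMem.mp (P.disj i j h hd.symm) _ ⟨h1, h2⟩

theorem biUnion_point_subset_board (P : Play N) (A : Finset (Fin N)) {τ : Fin N → Finset ℕ}
    (hτ : ∀ i, τ i ⊆ Finset.range 5) :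
    (A.biUnion fun i => (τ i).image (P.point i)) ⊆ P.board :=
  Finset.biUnion_subset.mpr fun i _ =>
    Finset.image_subset_iff.mpr fun _ ht => P.point_mem_board i (hτ i ht)

theorem five_mul_card_movesIn_le (P : Play N) (e : ℤ × ℤ) :
    5 * (P.movesIn e).card ≤ 36 + N := by
  have h := P.card_biUnion_point (Finset.Subset.refl (P.movesIn e))
    (τ := fun _ => Finset.range 5) fun _ => Finset.Subset.refl _
  have h2 := Finset.card_le_card (P.biUnion_point_subset_board (P.movesIn e)
    (τ := fun _ => Finset.range 5) fun _ => Finset.Subset.refl _)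
  rw [h] at h2
  simp only [Finset.card_range, Finset.sum_const, smul_eq_mul] at h2
  linarith [P.card_board_le]

theorem sum_card_movesIn (P : Play N) : ∑ e ∈ dirFinset, (P.movesIn e).card = N := by
  have h := Finset.card_eq_sum_card_fiberwise (s := (Finset.univ : Finset (Fin N))) (f := P.d)
    (t := dirFinset) fun i _ => mem_dirFinset.mpr (P.d_mem i)
  simpa [movesIn] using h.symm

/-- If more than `5 * k` lines have direction `e`, then some class of points modulo 5 contains
`k + 1` of them, while every line in another direction has 4 points outside that class. -/
theorem four_mul_card_movesIn_add_le (P : Play N) {e f : ℤ × ℤ} (he : e ∈ dirFinset)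
    (hf : f ∈ dirFinset) (hef : e ≠ f) {k : ℕ} (hk : 5 * k < (P.movesIn e).card) :
    4 * (P.movesIn f).card + 5 * (k + 1) ≤ 36 + N := by
  obtain ⟨c, -, hc⟩ := Finset.exists_lt_card_fiber_of_mul_lt_card_of_maps_to
    (s := P.movesIn e) (t := (Finset.univ : Finset (ZMod 5))) (n := k)
    (f := fun i => crossMod e (P.q i)) (fun _ _ => Finset.mem_univ _) (by simpa using hk)
  set B := (P.movesIn e).filter fun i => crossMod e (P.q i) = c
  let τ : Fin N → Finset ℕ := fun i =>
    (Finset.range 5).filter fun t : ℕ => crossMod e (P.q i) + t * crossMod e f ≠ c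
  have hτ : ∀ i, τ i ⊆ Finset.range 5 := fun i => Finset.filter_subset _ _
  have hB := P.card_biUnion_point (A := B) (Finset.filter_subset _ _)
    (τ := fun _ => Finset.range 5) fun _ => Finset.Subset.refl _
  have hA := P.card_biUnion_point (Finset.Subset.refl (P.movesIn f)) hτ
  have hdisj : Disjoint ((P.movesIn f).biUnion fun i => (τ i).image (P.point i))
      (B.biUnion fun i => (Finset.range 5).image (P.point i)) := by
    rw [Finset.disjoint_left]
    intro x hx hx'
    obtain ⟨i, hi, hx⟩ := Finset.mem_biUnion.mp hx
    obtain ⟨t, ht, rfl⟩ := Finset.mem_image.mp hx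
    obtain ⟨j, hj, hx'⟩ := Finset.mem_biUnion.mp hx'
    obtain ⟨s, -, hs⟩ := Finset.mem_image.mp hx'
    have hdi : P.d i = f := (Finset.mem_filter.mp hi).2
    have hj' := Finset.mem_filter.mp hj
    have hdj : P.d j = e := (Finset.mem_filter.mp hj'.1).2
    have h1 := (Finset.mem_filter.mp ht).2
    have h2 := congrArg (crossMod e) hs
    simp only [point, crossMod_add_smul, hdi, hdj, crossMod_self, mul_zero, add_zero, hj'.2] at h2
    exact h1 h2.symm
  have hcard := Finset.card_le_card (Finset.union_subset
    (P.biUnion_point_subset_board (P.movesIn f) hτ)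
    (P.biUnion_point_subset_board B (τ := fun _ => Finset.range 5) fun _ => Finset.Subset.refl _))
  rw [Finset.card_union_of_disjoint hdisj, hA, hB, Finset.sum_congr rfl fun i _ =>
    card_filter_add_mul_ne _ _ c (crossMod_ne_zero e he f hf hef)] at hcard
  simp only [Finset.card_range, Finset.sum_const, smul_eq_mul] at hcard
  linarith [P.card_board_le]

theorem false_of_length_122 (P : Play 122) : False := by
  have hle : ∀ e, (P.movesIn e).card ≤ 31 := fun e => by
    have := P.five_mul_card_movesIn_le e
    omega
  have hlt : ∀ e ∈ dirFinset, ∀ f ∈ dirFinset, e ≠ f →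
      (P.movesIn e).card + (P.movesIn f).card ≤ 61 := by
    intro e he f hf hef
    by_contra! h
    have h1 := hle e
    have h2 := hle f
    have := P.four_mul_card_movesIn_add_le he hf hef (k := 6) (by omega)
    omega
  have hsum := P.sum_card_movesIn
  have h12 := hlt (1, 0) (by decide) (0, 1) (by decide) (by decide)
  have h34 := hlt (1, 1) (by decide) (1, -1) (by decide) (by decide)
  have h13 := hlt (1, 0) (by decide) (1, 1) (by decide) (by decide)
  have h14 := hlt (1, 0) (by decide) (1, -1) (by decide) (by decide)
  have h23 := hlt (0, 1) (by decide) (1, 1) (by decide) (by decide)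
  have h24 := hlt (0, 1) (by decide) (1, -1) (by decide) (by decide)
  have h1 := hle (1, 0)
  have h2 := hle (0, 1)
  have h3 := hle (1, 1)
  have h4 := hle (1, -1)
  simp [dirFinset] at hsum
  omega

end Play

/-- In Morpion Solitaire 5D, the score of every play is at most 121;
equivalently, no play of length 122 exists. -/
theorem morpion5D_upper_bound_121 : ∀ N : ℕ, Play N → N ≤ 121 := by
  intro N P
  by_contra! h
  exact (P.truncate h).false_of_length_122
end

section
/- There exists a 5D-layout of 102 lines whose union covers at most 138 lattice points (so the minimum number of lattice points coverable by a 5D-layout of 102 lines is at most 102 + 36 = 138). -/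
/-- A 5D-layout of `N` lines: `N` pairwise distinct lines, each in a direction
from `Dir`, such that two distinct lines in the same direction are disjoint. -/
structure Layout (N : ℕ) where
  q : Fin N → ℤ × ℤ
  d : Fin N → ℤ × ℤ
  d_mem : ∀ i, d i ∈ Dir
  distinct : ∀ i j : Fin N, i ≠ j → seg (q i) (d i) ≠ seg (q j) (d j)
  disj : ∀ i j : Fin N, i ≠ j → d i = d j → seg (q i) (d i) ∩ seg (q j) (d j) = ∅

/-- The set of lattice points covered by the lines of a layout. -/
def Layout.covered {N : ℕ} (L : Layout N) : Set (ℤ × ℤ) := ⋃ i, seg (L.q i) (L.d i)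

/-- Starting points of the lines in direction `(1, 0)`. -/
def horizontalStarts : List (ℤ × ℤ) := [
    (0, 1), (5, 1), (10, 1), (15, 1), (20, 1), (25, 1), (1, 2), (7, 2), (12, 2), (18, 2),
    (23, 2), (2, 3), (7, 3), (12, 3), (17, 3), (23, 3), (3, 4), (8, 4), (13, 4), (18, 4),
    (23, 4), (4, 5), (9, 5), (14, 5), (19, 5), (24, 5)]

/-- Starting points of the lines in direction `(0, 1)`. -/
def verticalStarts : List (ℤ × ℤ) := [
    (6, 0), (2, 1), (3, 1), (4, 1), (5, 1), (7, 1), (8, 1), (9, 1), (10, 1), (11, 1), (12, 1),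
    (13, 1), (14, 1), (15, 1), (16, 1), (17, 1), (18, 1), (19, 1), (20, 1), (21, 1), (22, 1),
    (23, 1), (24, 1), (25, 1), (26, 1), (27, 1)]

/-- Starting points of the lines in direction `(1, 1)`. -/
def diagonalStarts : List (ℤ × ℤ) := [
    (0, 1), (1, 1), (2, 1), (3, 1), (4, 1), (5, 1), (6, 1), (7, 1), (8, 1), (9, 1), (10, 1),
    (11, 1), (12, 1), (13, 1), (14, 1), (15, 1), (16, 1), (17, 1), (18, 1), (19, 1), (20, 1),
    (21, 1), (22, 1), (23, 1), (24, 1)]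

/-- Starting points of the lines in direction `(1, -1)`. -/
def antidiagonalStarts : List (ℤ × ℤ) := [
    (2, 4), (2, 5), (3, 5), (4, 5), (5, 5), (6, 5), (7, 5), (8, 5), (9, 5), (10, 5), (11, 5),
    (12, 5), (13, 5), (14, 5), (15, 5), (16, 5), (17, 5), (18, 5), (19, 5), (20, 5), (21, 5),
    (22, 5), (23, 5), (24, 5), (25, 5)]

/-- The lines of the layout, as pairs of a starting point and a direction. -/
def layoutLines : List ((ℤ × ℤ) × (ℤ × ℤ)) :=
  horizontalStarts.map (·, (1, 0)) ++ verticalStarts.map (·, (0, 1)) ++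
    diagonalStarts.map (·, (1, 1)) ++ antidiagonalStarts.map (·, (1, -1))

/-- `n` consecutive points at height `y`, starting at abscissa `a`. -/
def row (a : ℤ) (n : ℕ) (y : ℤ) : List (ℤ × ℤ) := (List.range n).map fun k => (a + (k : ℤ), y)

/-- The points covered by the layout: a bar of six rows. -/
def bar : List (ℤ × ℤ) :=
  row 6 1 0 ++ row 0 30 1 ++ row 1 28 2 ++ row 2 26 3 ++ row 2 26 4 ++ row 2 27 5

theorem bar_length : bar.length = 138 := by
  decide +kernel

theorem layoutLines_length : layoutLines.length = 102 := by
  decide +kernel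

theorem layoutLines_mem_dir :
    ∀ l ∈ layoutLines, l.2 = (1, 0) ∨ l.2 = (0, 1) ∨ l.2 = (1, 1) ∨ l.2 = (1, -1) := by
  decide +kernel

theorem layoutLines_pairwise :
    layoutLines.Pairwise fun a b =>
      a.2 = b.2 → ∀ s < (5 : ℕ), ∀ t < (5 : ℕ), a.1 + (s : ℤ) • a.2 ≠ b.1 + (t : ℤ) • b.2 := by
  decide +kernel

theorem layoutLines_subset_bar :
    ∀ l ∈ layoutLines, ∀ t < (5 : ℕ), l.1 + (t : ℤ) • l.2 ∈ bar := by
  decide +kernel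

theorem left_mem_seg (q d : ℤ × ℤ) : q ∈ seg q d := ⟨0, by simp, by simp⟩

theorem add_mem_seg (q d : ℤ × ℤ) : q + d ∈ seg q d := ⟨1, by simp, by simp⟩

/-- A segment determines its direction. -/
theorem eq_of_seg_eq {q q' d d' : ℤ × ℤ} (hd : d ∈ Dir) (hd' : d' ∈ Dir)
    (h : seg q d = seg q' d') : d = d' := by
  obtain ⟨s, -, hs⟩ : q ∈ seg q' d' := h ▸ left_mem_seg q d
  obtain ⟨t, -, ht⟩ : q + d ∈ seg q' d' := h ▸ add_mem_seg q d
  simp only [Dir, Set.mem_insert_iff, Set.mem_singleton_iff] at hd hd'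
  rcases hd with rfl | rfl | rfl | rfl <;> rcases hd' with rfl | rfl | rfl | rfl <;>
    simp_all [Prod.ext_iff] <;> omega

theorem seg_inter_eq_empty {q q' d d' : ℤ × ℤ}
    (h : ∀ s < (5 : ℕ), ∀ t < (5 : ℕ), q + (s : ℤ) • d ≠ q' + (t : ℤ) • d') :
    seg q d ∩ seg q' d' = ∅ := by
  rw [Set.eq_empty_iff_forall_notMem]
  rintro p ⟨⟨s, hs, rfl⟩, ⟨t, ht, hp⟩⟩
  exact h s (by omega) t (by omega) hp

/-- The line with a given index. -/
def layoutLine (i : Fin 102) : (ℤ × ℤ) × (ℤ × ℤ) :=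
  layoutLines.get (i.cast layoutLines_length.symm)

theorem layoutLine_mem (i : Fin 102) : layoutLine i ∈ layoutLines := List.get_mem _ _

theorem layoutLine_mem_dir (i : Fin 102) : (layoutLine i).2 ∈ Dir :=
  layoutLines_mem_dir _ (layoutLine_mem i)

theorem layoutLine_disjoint (i j : Fin 102) (hij : i ≠ j)
    (hd : (layoutLine i).2 = (layoutLine j).2) :
    seg (layoutLine i).1 (layoutLine i).2 ∩ seg (layoutLine j).1 (layoutLine j).2 = ∅ := by
  have aux (a b : Fin 102) (hab : a < b) (hd : (layoutLine a).2 = (layoutLine b).2) :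
      seg (layoutLine a).1 (layoutLine a).2 ∩ seg (layoutLine b).1 (layoutLine b).2 = ∅ :=
    seg_inter_eq_empty (List.pairwise_iff_get.1 layoutLines_pairwise _ _ (by simpa using hab) hd)
  rcases lt_or_gt_of_ne hij with h | h
  · exact aux i j h hd
  · rw [Set.inter_comm]
    exact aux j i h hd.symm

/-- The bar-shaped layout of 102 lines. -/
def barLayout : Layout 102 where
  q i := (layoutLine i).1
  d i := (layoutLine i).2
  d_mem := layoutLine_mem_dir
  disj := layoutLine_disjoint
  distinct i j hij h := by
    have hd := eq_of_seg_eq (layoutLine_mem_dir i) (layoutLine_mem_dir j) h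
    have hempty := layoutLine_disjoint i j hij hd
    rw [← h, Set.inter_self] at hempty
    exact Set.eq_empty_iff_forall_notMem.1 hempty _ (left_mem_seg _ _)

theorem barLayout_covered_subset : barLayout.covered ⊆ (bar.toFinset : Set (ℤ × ℤ)) := by
  refine Set.iUnion_subset fun i => ?_
  rintro _ ⟨t, ht, rfl⟩
  exact List.mem_toFinset.2 (layoutLines_subset_bar _ (layoutLine_mem i) t (by omega))

/-- There is a 5D-layout of `102` lines covering at most `138 = 102 + 36`
lattice points. -/
theorem exists_layout_102 : ∃ L : Layout 102, L.covered.ncard ≤ 138 := by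
  refine ⟨barLayout, (Set.ncard_le_ncard barLayout_covered_subset bar.toFinset.finite_toSet).trans ?_⟩
  rw [Set.ncard_coe_finset]
  exact bar.toFinset_card_le.trans_eq bar_length
end
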